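/- arXiv:1711.02120 — 3 statements merged into one kernel-verified Lean document; each statement's English description precedes it below -/
import Mathlib

section
/- Fix i ≥ 1. Let G be the star graph with center x and leaves x_1,…,x_i,y, and let P be the poset on {x_1,…,x_i,y,x} generated by the relations x_j ≤ y for all j and y ≤ x. Then every P-elimination ordering of G has width exactly i+1; in particular, the dependency treewidth of G w.r.t. P is i+1. -/
/-! Elimination orderings, fill-in graphs, and dependency treewidth. -/

/-- The fill-in graph of `G` w.r.t. the elimination ordering `e : Fin n ≃ V`
(`e 0` is eliminated first): the unique minimal supergraph `H` of `G` such that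
whenever `k < i < j` and both `e i` and `e j` are neighbors of `e k` in `H`,
then `e i` and `e j` are adjacent in `H`. -/
def fillIn {V : Type} (G : SimpleGraph V) {n : ℕ} (e : Fin n ≃ V) : SimpleGraph V :=
  sInf {H : SimpleGraph V | G ≤ H ∧ ∀ k i j : Fin n, k < i → i < j →
    H.Adj (e k) (e i) → H.Adj (e k) (e j) → H.Adj (e i) (e j)}

/-- The width of the elimination ordering `e` of `G`: the maximum, over all vertices `v`,
of the number of neighbors of `v` in the fill-in graph that occur later than `v`. -/
noncomputable def elimWidth {V : Type} (G : SimpleGraph V) {n : ℕ} (e : Fin n ≃ V) : ℕ :=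
  Finset.univ.sup fun k : Fin n =>
    {i : Fin n | k < i ∧ (fillIn G e).Adj (e k) (e i)}.ncard

/-- `e` is a `P`-elimination ordering of `G` for the poset (relation) `r`:
it is a linear extension of the reverse of `r`, i.e. whenever `u ≤ v` and `u ≠ v`,
then `v` occurs before `u` in the ordering. -/
def IsDepElim {V : Type} (G : SimpleGraph V) (r : V → V → Prop) {n : ℕ}
    (e : Fin n ≃ V) : Prop :=
  ∀ u v : V, r u v → u ≠ v → e.symm v < e.symm u

/-- The dependency treewidth of `G` w.r.t. `r`: the minimum width of a
`P`-elimination ordering of `G`. -/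
noncomputable def depTreewidth {V : Type} [Fintype V] (G : SimpleGraph V)
    (r : V → V → Prop) : ℕ :=
  sInf {w : ℕ | ∃ e : Fin (Fintype.card V) ≃ V, IsDepElim G r e ∧ elimWidth G e = w}

/-- The star graph on `Fin (i+2)`: the center is the vertex `i+1`; the leaves are the
vertices `0, …, i-1` (representing `x_1, …, x_i`) and the vertex `i` (representing `y`). -/
def starGraph (i : ℕ) : SimpleGraph (Fin (i + 2)) :=
  SimpleGraph.fromRel fun a _ => a.val = i + 1

/-- The poset on the vertices of `starGraph i` generated by the relations `x_j ≤ y`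
(for all leaves `x_j`, i.e. vertices `< i`) and `y ≤ x` (where `y` is vertex `i` and
the center `x` is vertex `i+1`). -/
def starPoset (i : ℕ) (a b : Fin (i + 2)) : Prop :=
  a = b ∨ (a.val < i ∧ i ≤ b.val) ∨ (a.val = i ∧ b.val = i + 1)

theorem le_fillIn {V : Type} (G : SimpleGraph V) {n : ℕ} (e : Fin n ≃ V) : G ≤ fillIn G e :=
  le_sInf fun _ hH => hH.1

theorem elimWidth_le {V : Type} (G : SimpleGraph V) {n : ℕ} (e : Fin (n + 1) ≃ V) :
    elimWidth G e ≤ n := by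
  refine Finset.sup_le fun k _ => ?_
  calc _ ≤ (Set.Ioi k).ncard := Set.ncard_le_ncard (fun _ h => h.1) (Set.toFinite _)
    _ = n - k := by rw [← Finset.coe_Ioi, Set.ncard_coe_finset, Fin.card_Ioi]; omega
    _ ≤ n := Nat.sub_le _ _

/-- If the first eliminated vertex is adjacent to all others, the width is maximal. -/
theorem elimWidth_eq_of_first_universal {V : Type} (G : SimpleGraph V) {n : ℕ}
    (e : Fin (n + 1) ≃ V) (h : ∀ v, v ≠ e 0 → G.Adj (e 0) v) : elimWidth G e = n := by
  refine le_antisymm (elimWidth_le G e) ?_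
  have hset : {i : Fin (n + 1) | 0 < i ∧ (fillIn G e).Adj (e 0) (e i)} = Set.Ioi 0 := by
    ext m
    refine ⟨fun hm => hm.1, fun hm => ⟨hm, le_fillIn G e (h _ ?_)⟩⟩
    exact fun he => (ne_of_gt hm) (e.injective he)
  calc n = (Set.Ioi (0 : Fin (n + 1))).ncard := by
        rw [← Finset.coe_Ioi, Set.ncard_coe_finset, Fin.card_Ioi]; simp
    _ ≤ elimWidth G e := by
        rw [← hset]
        exact Finset.le_sup (f := fun k : Fin (n + 1) =>
          {i : Fin (n + 1) | k < i ∧ (fillIn G e).Adj (e k) (e i)}.ncard) (Finset.mem_univ 0)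

theorem starPoset_last {i : ℕ} (v : Fin (i + 2)) : starPoset i v (Fin.last (i + 1)) := by
  have hv : v.val < i + 2 := v.isLt
  have hl : (Fin.last (i + 1)).val = i + 1 := rfl
  unfold starPoset
  rw [Fin.ext_iff, hl]
  omega

theorem starPoset.le {i : ℕ} {u v : Fin (i + 2)} (h : starPoset i u v) : u ≤ v := by
  simp only [starPoset, Fin.ext_iff] at h
  rw [Fin.le_def]
  omega

theorem IsDepElim.elimWidth_starGraph {i : ℕ} {e : Fin (i + 2) ≃ Fin (i + 2)}
    (he : IsDepElim (starGraph i) (starPoset i) e) : elimWidth (starGraph i) e = i + 1 := by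
  have h0 : e 0 = Fin.last (i + 1) := by
    by_contra h
    have := he _ _ (starPoset_last (e 0)) h
    simp at this
  refine elimWidth_eq_of_first_universal _ e fun v hv => ?_
  rw [h0] at hv ⊢
  exact (SimpleGraph.fromRel_adj _ _ _).2 ⟨hv.symm, Or.inl (Fin.val_last _)⟩

theorem isDepElim_revPerm (i : ℕ) : IsDepElim (starGraph i) (starPoset i) Fin.revPerm := by
  intro u v h hne
  simpa using lt_of_le_of_ne h.le hne

theorem depTreewidth_eq_of_forall {V : Type} [Fintype V] {G : SimpleGraph V}
    {r : V → V → Prop} {n w : ℕ} (hn : Fintype.card V = n)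
    (hex : ∃ e : Fin n ≃ V, IsDepElim G r e)
    (h : ∀ e : Fin n ≃ V, IsDepElim G r e → elimWidth G e = w) : depTreewidth G r = w := by
  subst hn
  obtain ⟨e, he⟩ := hex
  have hset : {w : ℕ | ∃ e : Fin (Fintype.card V) ≃ V, IsDepElim G r e ∧ elimWidth G e = w}
      = {w} := by
    ext m
    refine ⟨fun ⟨e', he', hm⟩ => hm.symm.trans (h e' he'), fun hm => ⟨e, he, ?_⟩⟩
    exact (h e he).trans hm.symm
  rw [depTreewidth, hset, csInf_singleton]

/-- Every `P`-elimination ordering of the star graph (w.r.t. the poset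
generated by `x_j ≤ y` and `y ≤ x`) has width exactly `i + 1`; in particular, the
dependency treewidth of the star w.r.t. this poset is `i + 1`. -/
theorem star_depTreewidth_trivial_poset (i : ℕ) (hi : 1 ≤ i) :
    (∀ e : Fin (i + 2) ≃ Fin (i + 2),
      IsDepElim (starGraph i) (starPoset i) e → elimWidth (starGraph i) e = i + 1) ∧
    depTreewidth (starGraph i) (starPoset i) = i + 1 := by
  exact ⟨fun _ he => he.elimWidth_starGraph,
    depTreewidth_eq_of_forall (Fintype.card_fin _) ⟨_, isDepElim_revPerm i⟩
      fun _ he => he.elimWidth_starGraph⟩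
end

section
/- Fix i ≥ 2. Let G be the graph with vertices z, x_1,…,x_{2i}, y_1,…,y_{2i} and edges z–x_1, z–y_1, x_1–y_1, x_j–x_{j+1} and y_j–y_{j+1} for 1 ≤ j ≤ 2i−1, and x_{2j−1}–y_1 for 1 ≤ j ≤ i. Let P be the poset generated by the two chains x_{2i} ≤ … ≤ x_2 ≤ x_1 ≤ z and y_{2i} ≤ … ≤ y_2 ≤ y_1 ≤ z. Then: (a) the ordering z, x_1, x_2, …, x_{2i}, y_1, y_2, …, y_{2i} is a P-elimination ordering of G of width 2; and (b) every elimination ordering of G in which y_1 occurs before all of x_2,…,x_{2i} has width at least i−1. -/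
/-- The graph `F_i` on `Fin (4i+1)`: vertex `0` is `z`, vertex `j` (for `1 ≤ j ≤ 2i`)
is `x_j`, and vertex `2i+j` (for `1 ≤ j ≤ 2i`) is `y_j`.  Edges: `z–x₁`, `z–y₁`,
`x₁–y₁`, the chain edges `x_j–x_{j+1}` and `y_j–y_{j+1}` for `1 ≤ j ≤ 2i-1`, and
`x_{2j-1}–y₁` for `1 ≤ j ≤ i`. -/
def twoChainGraph (i : ℕ) : SimpleGraph (Fin (4 * i + 1)) :=
  SimpleGraph.fromRel fun a b =>
    (a.val = 0 ∧ b.val = 1) ∨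
    (a.val = 0 ∧ b.val = 2 * i + 1) ∨
    (a.val = 1 ∧ b.val = 2 * i + 1) ∨
    (∃ j : ℕ, 1 ≤ j ∧ j + 1 ≤ 2 * i ∧ a.val = j ∧ b.val = j + 1) ∨
    (∃ j : ℕ, 1 ≤ j ∧ j + 1 ≤ 2 * i ∧ a.val = 2 * i + j ∧ b.val = 2 * i + j + 1) ∨
    (∃ j : ℕ, 1 ≤ j ∧ j ≤ i ∧ a.val = 2 * j - 1 ∧ b.val = 2 * i + 1)

/-- The poset generated by the two chains `x_{2i} ≤ … ≤ x_2 ≤ x_1 ≤ z` and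
`y_{2i} ≤ … ≤ y_2 ≤ y_1 ≤ z`. -/
def twoChainPoset (i : ℕ) (a b : Fin (4 * i + 1)) : Prop :=
  a = b ∨ b.val = 0 ∨
  (1 ≤ b.val ∧ b.val ≤ a.val ∧ a.val ≤ 2 * i) ∨
  (2 * i + 1 ≤ b.val ∧ b.val ≤ a.val)

theorem fillIn_le {V : Type} {G H : SimpleGraph V} {n : ℕ} {e : Fin n ≃ V} (hGH : G ≤ H)
    (hH : ∀ k i j : Fin n, k < i → i < j →
      H.Adj (e k) (e i) → H.Adj (e k) (e j) → H.Adj (e i) (e j)) : fillIn G e ≤ H :=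
  sInf_le ⟨hGH, hH⟩

theorem ncard_laterNeighbors_le_elimWidth {V : Type} (G : SimpleGraph V) {n : ℕ}
    (e : Fin n ≃ V) (k : Fin n) :
    {i : Fin n | k < i ∧ (fillIn G e).Adj (e k) (e i)}.ncard ≤ elimWidth G e :=
  Finset.le_sup (f := fun k : Fin n =>
    {i : Fin n | k < i ∧ (fillIn G e).Adj (e k) (e i)}.ncard) (Finset.mem_univ k)

/-- Any finite family of neighbors of `v` in `G` that occur after `v` bounds the width below. -/
theorem card_le_elimWidth {V : Type} (G : SimpleGraph V) {n : ℕ} (e : Fin n ≃ V) (v : V)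
    (s : Finset V) (hs : ∀ u ∈ s, e.symm v < e.symm u ∧ G.Adj v u) :
    s.card ≤ elimWidth G e := by
  refine le_trans ?_ (ncard_laterNeighbors_le_elimWidth G e (e.symm v))
  rw [← Set.ncard_coe_finset s]
  refine Set.ncard_le_ncard_of_injOn e.symm (fun u hu => ?_) e.symm.injective.injOn
  obtain ⟨hlt, hadj⟩ := hs u hu
  exact ⟨hlt, by simpa using le_fillIn G e hadj⟩

/-- A path on all vertices together with all edges from the vertices `0, …, 2i` to `y_1`. -/
def twoChainFill (i : ℕ) : SimpleGraph (Fin (4 * i + 1)) :=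
  SimpleGraph.fromRel fun a b => b.val = a.val + 1 ∨ (a.val ≤ 2 * i ∧ b.val = 2 * i + 1)

theorem twoChainFill_adj_of_lt {i : ℕ} {a b : Fin (4 * i + 1)} (h : a < b) :
    (twoChainFill i).Adj a b ↔ b.val = a.val + 1 ∨ (a.val ≤ 2 * i ∧ b.val = 2 * i + 1) := by
  rw [twoChainFill, SimpleGraph.fromRel_adj]
  have hne : a ≠ b := h.ne
  rw [Fin.lt_def] at h
  simp only [hne, ne_eq, not_false_eq_true, true_and]
  omega

theorem twoChainGraph_le_twoChainFill (i : ℕ) : twoChainGraph i ≤ twoChainFill i := by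
  intro a b h
  rw [twoChainGraph, SimpleGraph.fromRel_adj] at h
  rw [twoChainFill, SimpleGraph.fromRel_adj]
  refine ⟨h.1, ?_⟩
  rcases h.2 with (h | h | h | ⟨j, h⟩ | ⟨j, h⟩ | ⟨j, h⟩) | (h | h | h | ⟨j, h⟩ | ⟨j, h⟩ | ⟨j, h⟩) <;>
    omega

theorem fillIn_refl_le_twoChainFill (i : ℕ) :
    fillIn (twoChainGraph i) (Equiv.refl _) ≤ twoChainFill i := by
  refine fillIn_le (twoChainGraph_le_twoChainFill i) fun k p q hkp hpq hp hq => ?_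
  simp only [Equiv.refl_apply] at hp hq ⊢
  rw [twoChainFill_adj_of_lt hkp] at hp
  rw [twoChainFill_adj_of_lt (hkp.trans hpq)] at hq
  rw [twoChainFill_adj_of_lt hpq]
  rw [Fin.lt_def] at hkp hpq
  omega

theorem elimWidth_refl_le_two (i : ℕ) : elimWidth (twoChainGraph i) (Equiv.refl _) ≤ 2 := by
  refine Finset.sup_le fun k _ => ?_
  refine le_trans (Set.ncard_le_ncard_of_injOn (t := ↑({k.val + 1, 2 * i + 1} : Finset ℕ)) Fin.val
    (fun p hp => ?_) Fin.val_injective.injOn)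
    ((Set.ncard_coe_finset _).trans_le Finset.card_le_two)
  have h := fillIn_refl_le_twoChainFill i hp.2
  simp only [Equiv.refl_apply] at h
  rw [twoChainFill_adj_of_lt hp.1] at h
  simp only [Finset.coe_insert, Finset.coe_singleton, Set.mem_insert_iff,
    Set.mem_singleton_iff]
  omega

theorem two_le_elimWidth_refl {i : ℕ} (hi : 1 ≤ i) :
    2 ≤ elimWidth (twoChainGraph i) (Equiv.refl _) := by
  have hne : (⟨1, by omega⟩ : Fin (4 * i + 1)) ≠ ⟨2 * i + 1, by omega⟩ := by
    simp only [ne_eq, Fin.mk.injEq]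
    omega
  rw [← Finset.card_pair hne]
  refine card_le_elimWidth _ _ ⟨0, by omega⟩ _ fun u hu => ?_
  simp only [Finset.mem_insert, Finset.mem_singleton] at hu
  rcases hu with rfl | rfl <;> simp [twoChainGraph, SimpleGraph.fromRel_adj, Fin.lt_def]

/-- (a) The ordering `z, x_1, …, x_{2i}, y_1, …, y_{2i}` (which is the
identity ordering in our encoding) is a `P`-elimination ordering of the graph of width
`2`.  (b) Every elimination ordering in which `y_1` occurs before all of
`x_2, …, x_{2i}` has width at least `i - 1`. -/
theorem twoChain_orderings (i : ℕ) (hi : 2 ≤ i) :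
    (IsDepElim (twoChainGraph i) (twoChainPoset i) (Equiv.refl (Fin (4 * i + 1))) ∧
      elimWidth (twoChainGraph i) (Equiv.refl (Fin (4 * i + 1))) = 2) ∧
    (∀ e : Fin (4 * i + 1) ≃ Fin (4 * i + 1),
      (∀ j : ℕ, 2 ≤ j → j ≤ 2 * i → ∀ (hj : j < 4 * i + 1),
        e.symm (⟨2 * i + 1, by omega⟩ : Fin (4 * i + 1)) < e.symm ⟨j, hj⟩) →
      i - 1 ≤ elimWidth (twoChainGraph i) e) := by
  refine ⟨⟨fun u v huv hne => ?_,
    (elimWidth_refl_le_two i).antisymm (two_le_elimWidth_refl (by omega))⟩, fun e he => ?_⟩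
  · have hval : u.val ≠ v.val := fun h => hne (Fin.ext h)
    simp only [Equiv.refl_symm, Equiv.refl_apply, Fin.lt_def]
    rcases huv with h | h | h | h
    · exact absurd h hne
    all_goals omega
  · let x : Fin (i - 1) ↪ Fin (4 * i + 1) :=
      ⟨fun t => ⟨2 * t.val + 3, by omega⟩, fun s t h => by
        simp only [Fin.mk.injEq] at h
        exact Fin.ext (by omega)⟩
    have hcard : (Finset.univ.map x).card = i - 1 := by simp
    rw [← hcard]
    refine card_le_elimWidth _ _ ⟨2 * i + 1, by omega⟩ _ fun u hu => ?_
    obtain ⟨t, -, rfl⟩ := Finset.mem_map.1 hu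
    refine ⟨he (2 * t.val + 3) (by omega) (by omega) (by omega), ?_⟩
    have hx : (x t).val = 2 * t.val + 3 := rfl
    rw [twoChainGraph, SimpleGraph.fromRel_adj]
    refine ⟨fun h => ?_, ?_⟩
    · have hval : 2 * i + 1 = (x t).val := congrArg Fin.val h
      omega
    · right
      iterate 5 right
      refine ⟨t.val + 2, by omega, by omega, ?_, rfl⟩
      omega
end

section
/- Let G be a finite graph, P a poset on V(G), and (T,χ) a dependency tree decomposition of G w.r.t. P of width ω. Then G has a dependency tree decomposition (T′,χ′) w.r.t. P of width at most ω that additionally satisfies: χ′(r)=∅ for the root r of T′, and for every node t of T′ with child c, the set χ′(T′_c) ∖ χ′(t) is a connected component of G ∖ χ′(t), where χ′(T′_c) denotes the union of the bags of all nodes in the subtree of T′ rooted at c. -/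
/-! Rooted tree decompositions. -/

/-- `t` is an ancestor of `s` in the tree `T` rooted at `root`
(every walk from the root to `s` passes through `t`; in a tree this says that `t`
lies on the unique path from the root to `s`).  In particular every node is an
ancestor of itself. -/
def ancIn {ι : Type} (T : SimpleGraph ι) (root t s : ι) : Prop :=
  ∀ w : T.Walk root s, t ∈ w.support

/-- `t` is a child of `p` in the tree `T` rooted at `root`. -/
def childIn {ι : Type} (T : SimpleGraph ι) (root p t : ι) : Prop :=
  T.Adj p t ∧ ancIn T root p t

/-- A (rooted) tree decomposition of the graph `G` with nodes indexed by `ι`: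
(T1) the bags cover `V(G)`, (T2) every edge of `G` is contained in some bag, and
(T3) for each vertex the nodes whose bags contain it induce a connected subtree. -/
structure TreeDecomp {V : Type} (G : SimpleGraph V) (ι : Type) [Fintype ι] : Type where
  T : SimpleGraph ι
  isTree : T.IsTree
  root : ι
  bag : ι → Finset V
  cover : ∀ v : V, ∃ t : ι, v ∈ bag t
  coverEdge : ∀ u v : V, G.Adj u v → ∃ t : ι, u ∈ bag t ∧ v ∈ bag t
  connBag : ∀ (v : V) (t₁ t₂ : ι), v ∈ bag t₁ → v ∈ bag t₂ →
    ∃ w : T.Walk t₁ t₂, ∀ s ∈ w.support, v ∈ bag s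

namespace TreeDecomp

variable {V : Type} {G : SimpleGraph V} {ι : Type} [Fintype ι]

/-- The width of a tree decomposition: maximum bag size minus one. -/
def width (D : TreeDecomp G ι) : ℕ :=
  (Finset.univ.sup fun t : ι => (D.bag t).card) - 1

/-- `t` is the `≤_T`-minimal (closest to the root) node whose bag contains `v`. -/
def IsTop (D : TreeDecomp G ι) (v : V) (t : ι) : Prop :=
  v ∈ D.bag t ∧ ∀ s : ι, v ∈ D.bag s → ancIn D.T D.root t s

/-- Property (T4): the decomposition is compatible with the relation `r`; whenever
`t_u` is a proper ancestor of `t_v`, it does not hold that `v ≤ u`. -/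
def Dep (D : TreeDecomp G ι) (r : V → V → Prop) : Prop :=
  ∀ (u v : V) (tu tv : ι), D.IsTop u tu → D.IsTop v tv →
    ancIn D.T D.root tu tv → tu ≠ tv → ¬ r v u

/-- The union of the bags of all nodes in the subtree rooted at `c`. -/
def subtreeBags (D : TreeDecomp G ι) (c : ι) : Set V :=
  {v : V | ∃ s : ι, ancIn D.T D.root c s ∧ v ∈ D.bag s}

end TreeDecomp

/-- `u` and `v` are connected in `G ∖ A` (by a walk avoiding `A`). -/
def ReachAvoid {V : Type} (G : SimpleGraph V) (A : Set V) (u v : V) : Prop :=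
  ∃ w : G.Walk u v, ∀ x ∈ w.support, x ∉ A

/-- `C` is a connected component of the graph `G ∖ A`. -/
def IsCompAvoid {V : Type} (G : SimpleGraph V) (A C : Set V) : Prop :=
  ∃ v : V, v ∉ A ∧ C = {u : V | ReachAvoid G A u v}

/-! Ancestors in rooted graphs. -/

section Ancestor

variable {ι : Type} {T : SimpleGraph ι} {root a b c s : ι}

theorem ancIn_refl : ancIn T root a a := fun w => w.end_mem_support

theorem ancIn.trans (hab : ancIn T root a b) (hbc : ancIn T root b c) : ancIn T root a c := by
  classical
  intro w
  exact w.support_takeUntil_subset_support (hbc w) (hab (w.takeUntil b (hbc w)))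

theorem ancIn.dist_lt (hT : T.Connected) (hab : ancIn T root a b) (hne : a ≠ b) :
    T.dist root a < T.dist root b := by
  classical
  obtain ⟨w, hw⟩ := hT.exists_walk_length_eq_dist root b
  rw [← hw]
  exact (SimpleGraph.dist_le _).trans_lt
    (SimpleGraph.Walk.length_takeUntil_lt_length (hab w) hne)

theorem ancIn.eq_of_dist_le (hT : T.Connected) (hab : ancIn T root a b)
    (h : T.dist root b ≤ T.dist root a) : a = b := by
  by_contra hne
  exact absurd (hab.dist_lt hT hne) (not_lt.mpr h)

theorem ancIn.antisymm (hT : T.Connected) (hab : ancIn T root a b) (hba : ancIn T root b a) :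
    a = b := by
  by_contra hne
  exact lt_asymm (hab.dist_lt hT hne) (hba.dist_lt hT (Ne.symm hne))

theorem ancIn_of_dist_le (hT : T.Connected) (hb : ancIn T root b s)
    (h : T.dist a s ≤ T.dist b s) : ancIn T root b a := by
  classical
  intro p
  obtain ⟨w, hw⟩ := hT.exists_walk_length_eq_dist a s
  rcases SimpleGraph.Walk.mem_support_append_iff _ _ |>.mp (hb (p.append w)) with hp | hbw
  · exact hp
  · by_contra hp
    have hne : b ≠ a := by
      rintro rfl
      exact hp p.end_mem_support
    have h₁ := SimpleGraph.Walk.length_dropUntil_lt_length hbw hne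
    have h₂ := SimpleGraph.dist_le (w.dropUntil b hbw)
    omega

/-- Two ancestors of the same node are comparable. -/
theorem ancIn.total (hT : T.Connected) (ha : ancIn T root a s) (hb : ancIn T root b s) :
    ancIn T root a b ∨ ancIn T root b a :=
  (le_total (T.dist b s) (T.dist a s)).imp (ancIn_of_dist_le hT ha)
    (ancIn_of_dist_le hT hb)

/-- In a tree, one endpoint of each edge is an ancestor of the other. -/
theorem ancIn_or_ancIn_of_adj (hT : T.IsTree) (h : T.Adj a b) :
    ancIn T root a b ∨ ancIn T root b a := by
  by_contra! hcon
  simp only [ancIn, not_forall] at hcon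
  obtain ⟨⟨q, hq⟩, p, hp⟩ := hcon
  have hmem := SimpleGraph.isBridge_iff_forall_walk_mem_edges.mp
    (SimpleGraph.isAcyclic_iff_forall_adj_isBridge.mp hT.isAcyclic h) (p.reverse.append q)
  rw [SimpleGraph.Walk.edges_append, List.mem_append, SimpleGraph.Walk.edges_reverse,
    List.mem_reverse] at hmem
  rcases hmem with hmem | hmem
  · exact hp (p.snd_mem_support_of_mem_edges hmem)
  · exact hq (q.fst_mem_support_of_mem_edges hmem)

end Ancestor

/-! Top nodes. -/

namespace TreeDecomp

variable {V : Type} {G : SimpleGraph V} {ι : Type} [Fintype ι] (D : TreeDecomp G ι)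

theorem exists_isTop (v : V) : ∃ t, D.IsTop v t := by
  obtain ⟨t, ht, hmin⟩ := Set.exists_min_image {t | v ∈ D.bag t} (D.T.dist D.root)
    (Set.toFinite _) (D.cover v)
  refine ⟨t, ht, fun s hs => ?_⟩
  obtain ⟨w, hw⟩ := D.connBag v t s ht hs
  have key : ∀ {a b : ι} (w : D.T.Walk a b), (∀ x ∈ w.support, v ∈ D.bag x) →
      ancIn D.T D.root t a → ancIn D.T D.root t b := by
    intro a b w
    induction w with
    | nil => exact fun _ h => h
    | @cons a a' b h p ih =>
      intro hw hta
      have ha' : v ∈ D.bag a' := hw a' (by simp)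
      refine ih (fun x hx => hw x (by simp [hx])) ?_
      rcases ancIn_or_ancIn_of_adj (root := D.root) D.isTree h with h' | h'
      · exact hta.trans h'
      · rcases hta.total D.isTree.connected h' with h'' | h''
        · exact h''
        · rw [h''.eq_of_dist_le D.isTree.connected (hmin a' ha')]
          exact ancIn_refl
  exact key w hw ancIn_refl

variable {D}

theorem IsTop.unique {v : V} {s t : ι} (hs : D.IsTop v s) (ht : D.IsTop v t) : s = t :=
  (hs.2 t ht.1).antisymm D.isTree.connected (ht.2 s hs.1)

theorem IsTop.mem_bag_of_ancIn {v : V} {s t a : ι} (ht : D.IsTop v t) (hs : v ∈ D.bag s)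
    (hta : ancIn D.T D.root t a) (has : ancIn D.T D.root a s) : v ∈ D.bag a := by
  classical
  obtain ⟨w, hw⟩ := D.connBag v t s ht.1 hs
  obtain ⟨p, hp⟩ := D.isTree.connected.exists_walk_length_eq_dist D.root t
  rcases SimpleGraph.Walk.mem_support_append_iff _ _ |>.mp (has (p.append w)) with h | h
  · have h₁ := (SimpleGraph.dist_le (p.takeUntil a h)).trans
      (p.length_takeUntil_le_length h)
    rw [hp] at h₁
    rw [← hta.eq_of_dist_le D.isTree.connected h₁]
    exact ht.1
  · exact hw a h

end TreeDecomp

/-! Trees given by a parent function. -/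

/-- The graph joining every element to its image under `par`. -/
def parentGraph {ι : Type} (par : ι → ι) : SimpleGraph ι :=
  SimpleGraph.fromRel fun a b => par a = b

section ParentGraph

variable {ι : Type} {par : ι → ι} {root : ι} {rk : ι → ℕ}

theorem parentGraph_adj {a b : ι} :
    (parentGraph par).Adj a b ↔ a ≠ b ∧ (par a = b ∨ par b = a) :=
  SimpleGraph.fromRel_adj _ _ _

/-- `Descends par s t` says that iterating `par` from `s` leads to `t`. -/
def Descends {ι : Type} (par : ι → ι) (s t : ι) : Prop :=
  Relation.ReflTransGen (fun a b => par a = b) s t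

theorem Descends.refl (s : ι) : Descends par s s := Relation.ReflTransGen.refl

theorem Descends.head {a b t : ι} (h : par a = b) (hb : Descends par b t) : Descends par a t :=
  Relation.ReflTransGen.head (r := fun a b => par a = b) h hb

theorem Descends.eq_or_descends_par {s t : ι} (h : Descends par s t) :
    s = t ∨ Descends par (par s) t := by
  rcases Relation.ReflTransGen.cases_head h with h | ⟨c, rfl, h⟩
  · exact Or.inl h
  · exact Or.inr h

theorem Descends.eq_of_root {t : ι} (hroot : par root = root) (h : Descends par root t) :
    t = root := by
  induction h with
  | refl => rfl
  | tail _ h ih => rw [← h, ih, hroot]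

theorem Descends.rank_le (hroot : par root = root) (hrk : ∀ t, t ≠ root → rk (par t) < rk t)
    {s t : ι} (h : Descends par s t) : rk t ≤ rk s := by
  induction h with
  | refl => rfl
  | @tail b c _ h ih =>
    subst h
    by_cases hb : b = root
    · rw [hb, hroot, ← hb]
      exact ih
    · exact (hrk b hb).le.trans ih

theorem eq_of_parentGraph_adj {a b t : ι} (h : (parentGraph par).Adj a b)
    (ha : ¬ Descends par a t) (hb : Descends par b t) : b = t ∧ par b = a := by
  rcases (parentGraph_adj.mp h).2 with h' | h'
  · exact absurd (Descends.head h' hb) ha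
  · refine ⟨?_, h'⟩
    rcases hb.eq_or_descends_par with h'' | h''
    · exact h''
    · rw [h'] at h''
      exact absurd h'' ha

theorem exists_walk_descends (hrk : ∀ t, t ≠ root → rk (par t) < rk t) (s : ι) :
    ∃ w : (parentGraph par).Walk root s, ∀ x ∈ w.support, Descends par s x := by
  induction hk : rk s using Nat.strong_induction_on generalizing s with
  | _ k ih =>
    by_cases hs : s = root
    · subst hs
      exact ⟨.nil, by simp [Descends.refl]⟩
    · have hlt := hrk s hs
      obtain ⟨w, hw⟩ := ih _ (hk ▸ hlt) (par s) rfl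
      have hne : par s ≠ s := fun h => by rw [h] at hlt; exact lt_irrefl _ hlt
      refine ⟨w.concat (parentGraph_adj.mpr ⟨hne, Or.inr rfl⟩), fun x hx => ?_⟩
      rw [SimpleGraph.Walk.support_concat, List.mem_append,
        List.mem_singleton] at hx
      rcases hx with hx | rfl
      · exact Descends.head rfl (hw x hx)
      · exact Descends.refl _

theorem parentGraph_isTree (hroot : par root = root)
    (hrk : ∀ t, t ≠ root → rk (par t) < rk t) : (parentGraph par).IsTree := by
  have hreach : ∀ s, (parentGraph par).Reachable root s := fun s =>
    let ⟨w, _⟩ := exists_walk_descends hrk s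
    ⟨w⟩
  have : Nonempty ι := ⟨root⟩
  refine ⟨⟨fun a b => (hreach a).symm.trans (hreach b)⟩, ?_⟩
  have key : ∀ a, par a ≠ a → (parentGraph par).IsBridge s(par a, a) := by
    intro a hne
    rw [SimpleGraph.isBridge_iff_forall_walk_mem_edges]
    intro w
    have ha : a ≠ root := fun h => hne (by rw [h, hroot])
    have hpar : ¬ Descends par (par a) a := fun h =>
      absurd (h.rank_le hroot hrk) (not_le.mpr (hrk a ha))
    obtain ⟨d, hd, hfst, hsnd⟩ := w.exists_boundary_dart {x | ¬ Descends par x a} hpar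
      (not_not.mpr (Descends.refl a))
    obtain ⟨h₁, h₂⟩ := eq_of_parentGraph_adj d.adj hfst (not_not.mp hsnd)
    rw [h₁] at h₂
    have : d.edge ∈ w.edges := List.mem_map_of_mem hd
    rwa [SimpleGraph.Dart.edge, show d.toProd = (par a, a) from Prod.ext h₂.symm h₁] at this
  rw [SimpleGraph.isAcyclic_iff_forall_adj_isBridge]
  intro a b h
  obtain ⟨hne, h | h⟩ := parentGraph_adj.mp h
  · subst h
    rw [Sym2.eq_swap]
    exact key a hne.symm
  · subst h
    exact key b hne

theorem ancIn_parentGraph_iff (hroot : par root = root)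
    (hrk : ∀ t, t ≠ root → rk (par t) < rk t) {t s : ι} :
    ancIn (parentGraph par) root t s ↔ Descends par s t := by
  constructor
  · intro h
    obtain ⟨w, hw⟩ := exists_walk_descends hrk s
    exact hw t (h w)
  · intro h w
    by_cases hr : Descends par root t
    · rw [hr.eq_of_root hroot]
      exact w.start_mem_support
    · obtain ⟨d, hd, hfst, hsnd⟩ := w.exists_boundary_dart {x | ¬ Descends par x t} hr
        (not_not.mpr h)
      rw [← (eq_of_parentGraph_adj d.adj hfst (not_not.mp hsnd)).1]
      exact w.dart_snd_mem_support_of_mem_darts hd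

theorem childIn_parentGraph (hroot : par root = root)
    (hrk : ∀ t, t ≠ root → rk (par t) < rk t) {t c : ι}
    (h : childIn (parentGraph par) root t c) : c ≠ root ∧ par c = t := by
  obtain ⟨hadj, hanc⟩ := h
  rw [ancIn_parentGraph_iff hroot hrk] at hanc
  obtain ⟨hne, h⟩ := parentGraph_adj.mp hadj
  have hc : c ≠ root := by
    rintro rfl
    exact hne (hanc.eq_of_root hroot)
  refine ⟨hc, ?_⟩
  rcases h with h | h
  · have ht : t ≠ root := by
      rintro rfl
      exact hne (hroot.symm.trans h)
    have h₁ := hanc.rank_le hroot hrk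
    have h₂ := hrk t ht
    rw [h] at h₂
    omega
  · exact h

end ParentGraph

/-! Elimination along an injective rank: `f` lists the vertices, the largest value being
eliminated first. -/

/-- The component of `v` in the subgraph induced by the vertices of rank at least `f v`. -/
def elimComp {V : Type} (G : SimpleGraph V) (f : V → ℕ) (v : V) : Set V :=
  {u | ReachAvoid G {x | f x < f v} u v}

/-- The vertices of rank less than `f v` with a neighbor in `elimComp G f v`. -/
def elimNbrs {V : Type} (G : SimpleGraph V) (f : V → ℕ) (v : V) : Set V :=
  {a | f a < f v ∧ ∃ x ∈ elimComp G f v, G.Adj a x}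

section Elimination

variable {V : Type} {G : SimpleGraph V} {f : V → ℕ} {a p u v x y : V}

theorem ReachAvoid.cons {A : Set V} (h : ReachAvoid G A x v) (hadj : G.Adj y x) (hy : y ∉ A) :
    ReachAvoid G A y v := by
  obtain ⟨w, hw⟩ := h
  refine ⟨.cons hadj w, fun z hz => ?_⟩
  rw [SimpleGraph.Walk.support_cons, List.mem_cons] at hz
  rcases hz with rfl | hz
  · exact hy
  · exact hw z hz

theorem ReachAvoid.symm {A : Set V} (h : ReachAvoid G A x v) : ReachAvoid G A v x := by
  obtain ⟨w, hw⟩ := h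
  exact ⟨w.reverse, fun z hz => hw z (by simpa using hz)⟩

theorem ReachAvoid.trans {A : Set V} (h : ReachAvoid G A x y) (h' : ReachAvoid G A y v) :
    ReachAvoid G A x v := by
  obtain ⟨w, hw⟩ := h
  obtain ⟨w', hw'⟩ := h'
  refine ⟨w.append w', fun z hz => ?_⟩
  rcases (SimpleGraph.Walk.mem_support_append_iff _ _).mp hz with hz | hz
  · exact hw z hz
  · exact hw' z hz

theorem ReachAvoid.mono {A B : Set V} (hAB : B ⊆ A) (h : ReachAvoid G A x y) :
    ReachAvoid G B x y := by
  obtain ⟨w, hw⟩ := h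
  exact ⟨w, fun z hz hB => hw z hz (hAB hB)⟩

/-- A set closed under taking neighbors outside `A` is closed under walks avoiding `A`. -/
theorem ReachAvoid.mem_of_closed {A C : Set V} (h : ReachAvoid G A x y) (hy : y ∈ C)
    (hC : ∀ a b, b ∈ C → G.Adj a b → a ∉ A → a ∈ C) : x ∈ C := by
  obtain ⟨w, hw⟩ := h
  induction w with
  | nil => exact hy
  | cons hadj w ih =>
    exact hC _ _ (ih hy fun z hz => hw z (by simp [hz])) hadj (hw _ (by simp))

theorem mem_elimComp_self : v ∈ elimComp G f v := ⟨.nil, by simp⟩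

theorem le_of_mem_elimComp (h : u ∈ elimComp G f v) : f v ≤ f u := by
  obtain ⟨w, hw⟩ := h
  exact not_lt.mp (hw u w.start_mem_support)

theorem elimComp_subset (h : x ∈ elimComp G f v) : elimComp G f x ⊆ elimComp G f v :=
  fun _ hy => (hy.mono fun _ hz => lt_of_lt_of_le hz (le_of_mem_elimComp h)).trans h

theorem mem_elimComp_of_adj (h : x ∈ elimComp G f v) (hadj : G.Adj y x) (hy : f v ≤ f y) :
    y ∈ elimComp G f v :=
  h.cons hadj (not_lt.mpr hy)

theorem mem_elimComp_of_mem_elimNbrs (h : a ∈ elimNbrs G f v) : v ∈ elimComp G f a := by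
  obtain ⟨hlt, x, hx, hadj⟩ := h
  have hx' : ReachAvoid G {x | f x < f a} x v := hx.mono fun _ hz => lt_trans hz hlt
  exact hx'.symm.trans (mem_elimComp_self.cons hadj.symm
    (not_lt.mpr (hlt.le.trans (le_of_mem_elimComp hx))))

theorem elimNbrs_subset (h : x ∈ elimComp G f v) (ha : a ∈ elimNbrs G f x) :
    a ∈ elimComp G f v ∨ a ∈ elimNbrs G f v := by
  obtain ⟨-, y, hy, hadj⟩ := ha
  have hy' := elimComp_subset h hy
  rcases lt_or_ge (f a) (f v) with hlt | hge
  · exact Or.inr ⟨hlt, y, hy', hadj⟩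
  · exact Or.inl (mem_elimComp_of_adj hy' hadj hge)

/-- If `p` is the vertex of largest rank in `elimNbrs G f v`, every other one is in
`elimNbrs G f p`. -/
theorem mem_elimNbrs_of_isMax (hf : f.Injective) (hp : p ∈ elimNbrs G f v)
    (hmax : ∀ a ∈ elimNbrs G f v, f a ≤ f p) (ha : a ∈ elimNbrs G f v) (hne : a ≠ p) :
    a ∈ elimNbrs G f p := by
  obtain ⟨-, x, hx, hadj⟩ := id ha
  exact ⟨lt_of_le_of_ne (hmax a ha) fun h => hne (hf h), x,
    elimComp_subset (mem_elimComp_of_mem_elimNbrs hp) hx, hadj⟩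

/-- A vertex `x ≠ v` of the component of `v` has a next vertex in that component. -/
theorem exists_mem_elimNbrs (hf : f.Injective) (hx : x ∈ elimComp G f v) (hne : x ≠ v) :
    ∃ b ∈ elimNbrs G f x, f v ≤ f b := by
  have hlt : f v < f x := lt_of_le_of_ne (le_of_mem_elimComp hx) fun h => hne (hf h).symm
  obtain ⟨w, hw⟩ := hx
  obtain ⟨d, hd, hfst, hsnd⟩ := w.exists_boundary_dart (elimComp G f x) mem_elimComp_self
    fun h => absurd (le_of_mem_elimComp h) (not_le.mpr hlt)
  have hlt' : f d.snd < f x := by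
    by_contra hge
    exact hsnd (mem_elimComp_of_adj hfst d.adj.symm (not_lt.mp hge))
  exact ⟨d.snd, ⟨hlt', d.fst, hfst, d.adj.symm⟩,
    not_lt.mp (hw _ (w.dart_snd_mem_support_of_mem_darts hd))⟩

theorem exists_elimParent [Finite V] (G : SimpleGraph V) (f : V → ℕ) :
    ∃ par : V → Option V, (∀ v, par v = none → elimNbrs G f v = ∅) ∧
      ∀ v p, par v = some p → p ∈ elimNbrs G f v ∧ ∀ a ∈ elimNbrs G f v, f a ≤ f p := by
  have h : ∀ v, ∃ o : Option V, (o = none → elimNbrs G f v = ∅) ∧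
      ∀ p, o = some p → p ∈ elimNbrs G f v ∧ ∀ a ∈ elimNbrs G f v, f a ≤ f p := by
    intro v
    rcases (elimNbrs G f v).eq_empty_or_nonempty with h | h
    · exact ⟨none, fun _ => h, by simp⟩
    · obtain ⟨p, hp, hmax⟩ := Set.exists_max_image _ f (Set.toFinite _) h
      refine ⟨some p, by simp, ?_⟩
      rintro _ ⟨⟩
      exact ⟨hp, hmax⟩
  choose par h using h
  exact ⟨par, fun v => (h v).1, fun v => (h v).2⟩

/-- The tree decomposition obtained by eliminating the vertices of `G` in order of decreasing
rank: besides a root with empty bag it has one node `node v` for each vertex `v`. -/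
theorem exists_treeDecomp_of_injective [Fintype V] (G : SimpleGraph V) (hf : f.Injective) :
    ∃ (m : ℕ) (D : TreeDecomp G (Fin m)) (node : V → Fin m),
      D.bag D.root = ∅ ∧ (∀ t, t ≠ D.root → ∃ v, t = node v) ∧
      (∀ v, (D.bag (node v) : Set V) = insert v (elimNbrs G f v)) ∧
      (∀ v, D.IsTop v (node v)) ∧
      (∀ u v, ancIn D.T D.root (node u) (node v) → v ∈ elimComp G f u) ∧
      ∀ t c, childIn D.T D.root t c → IsCompAvoid G (D.bag t : Set V)
        (D.subtreeBags c \ (D.bag t : Set V)) := by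
  classical
  obtain ⟨par₀, hnone, hsome⟩ := exists_elimParent G f
  let e : Option V ≃ Fin (Fintype.card (Option V)) := Fintype.equivFin _
  let node : V → Fin (Fintype.card (Option V)) := fun v => e (some v)
  let root := e none
  let par : Fin (Fintype.card (Option V)) → Fin (Fintype.card (Option V)) :=
    fun i => e ((e.symm i).bind par₀)
  let bag : Fin (Fintype.card (Option V)) → Finset V :=
    fun i => (e.symm i).elim ∅ fun v => (insert v (elimNbrs G f v)).toFinset
  let rk : Fin (Fintype.card (Option V)) → ℕ := fun i => (e.symm i).elim 0 fun v => f v + 1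
  have hcases : ∀ t, t = root ∨ ∃ v, t = node v := by
    intro t
    obtain ⟨o, rfl⟩ := e.surjective t
    cases o with
    | none => exact Or.inl rfl
    | some v => exact Or.inr ⟨v, rfl⟩
  have hnode : ∀ v, node v ≠ root := by simp [node, root]
  have hinj : ∀ {u v}, node u = node v → u = v := by simp [node]
  have hroot : par root = root := by simp [par, root]
  have hparnone : ∀ v, par (node v) = root → elimNbrs G f v = ∅ := by
    intro v h
    exact hnone v (by simpa [par, node, root] using h)
  have hparsome : ∀ v p, par (node v) = node p →
      p ∈ elimNbrs G f v ∧ ∀ a ∈ elimNbrs G f v, f a ≤ f p := by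
    intro v p h
    exact hsome v p (by simpa [par, node] using h)
  have hbagroot : bag root = ∅ := by simp [bag, root]
  have hbag : ∀ v, (bag (node v) : Set V) = insert v (elimNbrs G f v) := by simp [bag, node]
  have hmem : ∀ u v, u ∈ bag (node v) ↔ u = v ∨ u ∈ elimNbrs G f v := by
    intro u v
    rw [← Finset.mem_coe, hbag, Set.mem_insert_iff]
  have hrk : ∀ t, t ≠ root → rk (par t) < rk t := by
    intro t ht
    obtain ⟨v, rfl⟩ := (hcases t).resolve_left ht
    have hv : rk (node v) = f v + 1 := by simp [rk, node]
    rcases hcases (par (node v)) with h | ⟨p, h⟩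
    · rw [h, hv]
      simp [rk, root]
    · have hp : rk (node p) = f p + 1 := by simp [rk, node]
      rw [h, hv, hp]
      exact Nat.succ_lt_succ (hparsome v p h).1.1
  have hbagpar : ∀ v a, a ∈ elimNbrs G f v → a ∈ bag (par (node v)) := by
    intro v a ha
    rcases hcases (par (node v)) with h | ⟨p, h⟩
    · rw [hparnone v h] at ha
      exact ha.elim
    · obtain ⟨hp, hmax⟩ := hparsome v p h
      rw [h, hmem]
      by_cases hap : a = p
      · exact Or.inl hap
      · exact Or.inr (mem_elimNbrs_of_isMax hf hp hmax ha hap)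
  have hdesc : ∀ u x, Descends par (node x) (node u) → x ∈ elimComp G f u := by
    intro u x h
    induction hk : f x using Nat.strong_induction_on generalizing x with
    | _ k ih =>
      rcases h.eq_or_descends_par with h' | h'
      · rw [hinj h']
        exact mem_elimComp_self
      · rcases hcases (par (node x)) with hp | ⟨p, hp⟩
        · rw [hp] at h'
          exact absurd (h'.eq_of_root hroot) (hnode u)
        · rw [hp] at h'
          have hpx := (hparsome x p hp).1
          exact elimComp_subset (ih _ (hk ▸ hpx.1) p h' rfl) (mem_elimComp_of_mem_elimNbrs hpx)
  have hdesc' : ∀ u x, x ∈ elimComp G f u → Descends par (node x) (node u) := by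
    intro u x h
    induction hk : f x using Nat.strong_induction_on generalizing x with
    | _ k ih =>
      by_cases hxu : x = u
      · rw [hxu]
        exact Descends.refl _
      · obtain ⟨b, hb, hub⟩ := exists_mem_elimNbrs hf h hxu
        rcases hcases (par (node x)) with hp | ⟨p, hp⟩
        · rw [hparnone x hp] at hb
          exact hb.elim
        · obtain ⟨hpx, hmax⟩ := hparsome x p hp
          obtain ⟨hlt, y, hy, hadj⟩ := id hpx
          exact Descends.head hp (ih _ (hk ▸ hlt) p (mem_elimComp_of_adj
            (elimComp_subset h hy) hadj (hub.trans (hmax b hb))) rfl)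
  have hconn : ∀ v x, v ∈ bag (node x) →
      ∃ w : (parentGraph par).Walk (node x) (node v), ∀ s ∈ w.support, v ∈ bag s := by
    intro v x h
    induction hk : f x using Nat.strong_induction_on generalizing x with
    | _ k ih =>
      by_cases hvx : v = x
      · subst hvx
        exact ⟨.nil, by simpa using h⟩
      · have hv := ((hmem v x).mp h).resolve_left hvx
        have hv' := hbagpar x v hv
        rcases hcases (par (node x)) with hp | ⟨p, hp⟩
        · rw [hparnone x hp] at hv
          exact hv.elim
        · rw [hp] at hv'
          have hlt := (hparsome x p hp).1.1
          obtain ⟨w, hw⟩ := ih _ (hk ▸ hlt) p hv' rfl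
          have hne : node x ≠ node p := fun h => by
            rw [hinj h] at hlt
            exact lt_irrefl _ hlt
          refine ⟨.cons (parentGraph_adj.mpr ⟨hne, Or.inl hp⟩) w, fun s hs => ?_⟩
          rw [SimpleGraph.Walk.support_cons, List.mem_cons] at hs
          rcases hs with rfl | hs
          · exact h
          · exact hw s hs
  have hconn' : ∀ v t, v ∈ bag t →
      ∃ w : (parentGraph par).Walk t (node v), ∀ s ∈ w.support, v ∈ bag s := by
    intro v t h
    rcases hcases t with rfl | ⟨x, rfl⟩
    · simp [hbagroot] at h
    · exact hconn v x h
  let D : TreeDecomp G (Fin (Fintype.card (Option V))) :=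
    { T := parentGraph par
      isTree := parentGraph_isTree hroot hrk
      root := root
      bag := bag
      cover := fun v => ⟨node v, (hmem v v).mpr (Or.inl rfl)⟩
      coverEdge := by
        have key : ∀ u v, G.Adj u v → f u < f v → u ∈ bag (node v) ∧ v ∈ bag (node v) :=
          fun u v h hlt => ⟨(hmem u v).mpr (Or.inr ⟨hlt, v, mem_elimComp_self, h⟩),
            (hmem v v).mpr (Or.inl rfl)⟩
        intro u v h
        rcases lt_or_gt_of_ne (hf.ne h.ne) with hlt | hlt
        · exact ⟨node v, key u v h hlt⟩
        · exact ⟨node u, (key v u h.symm hlt).symm⟩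
      connBag := by
        intro v t₁ t₂ h₁ h₂
        obtain ⟨w₁, hw₁⟩ := hconn' v t₁ h₁
        obtain ⟨w₂, hw₂⟩ := hconn' v t₂ h₂
        refine ⟨w₁.append w₂.reverse, fun s hs => ?_⟩
        rcases (SimpleGraph.Walk.mem_support_append_iff _ _).mp hs with hs | hs
        · exact hw₁ s hs
        · exact hw₂ s (by simpa using hs) }
  have hanc : ∀ u x, ancIn D.T D.root (node u) (node x) ↔ x ∈ elimComp G f u := fun u x =>
    (ancIn_parentGraph_iff hroot hrk).trans ⟨hdesc u x, hdesc' u x⟩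
  refine ⟨_, D, node, hbagroot, fun t ht => (hcases t).resolve_left ht, hbag, ?_,
    fun u v => (hanc u v).mp, ?_⟩
  · intro v
    refine ⟨(hmem v v).mpr (Or.inl rfl), fun s hs => ?_⟩
    change v ∈ bag s at hs
    rcases hcases s with rfl | ⟨x, rfl⟩
    · simp [hbagroot] at hs
    · rw [hanc]
      rcases (hmem v x).mp hs with rfl | hs
      · exact mem_elimComp_self
      · exact mem_elimComp_of_mem_elimNbrs hs
  · intro t c htc
    obtain ⟨hc, rfl⟩ := childIn_parentGraph hroot hrk htc
    obtain ⟨c, rfl⟩ := (hcases c).resolve_left hc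
    change IsCompAvoid G (bag (par (node c)) : Set V)
      (D.subtreeBags (node c) \ (bag (par (node c)) : Set V))
    have hlt : ∀ a ∈ bag (par (node c)), f a < f c := by
      intro a ha
      rcases hcases (par (node c)) with h | ⟨p, h⟩
      · rw [h, hbagroot] at ha
        simp at ha
      · have hpc := (hparsome c p h).1.1
        rw [h, hmem] at ha
        rcases ha with rfl | ha
        · exact hpc
        · exact ha.1.trans hpc
    have hsub : D.subtreeBags (node c) \ (bag (par (node c)) : Set V) = elimComp G f c := by
      ext y
      constructor
      · rintro ⟨⟨s, hs, hy⟩, hy'⟩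
        change y ∈ bag s at hy
        rcases hcases s with rfl | ⟨x, rfl⟩
        · simp [hbagroot] at hy
        · rw [hanc] at hs
          rcases (hmem y x).mp hy with rfl | hy
          · exact hs
          · exact (elimNbrs_subset hs hy).resolve_right fun h => hy' (hbagpar c y h)
      · intro hy
        exact ⟨⟨node y, (hanc c y).mpr hy, (hmem y y).mpr (Or.inl rfl)⟩,
          fun h => absurd (hlt y h) (not_lt.mpr (le_of_mem_elimComp hy))⟩
    rw [hsub]
    refine ⟨c, fun h => lt_irrefl _ (hlt c h), ?_⟩
    ext y
    constructor
    · exact fun hy => hy.mono hlt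
    · refine fun hy => hy.mem_of_closed mem_elimComp_self fun a b hb hadj ha => ?_
      refine mem_elimComp_of_adj hb hadj (not_lt.mp fun hac => ?_)
      exact ha (hbagpar c a ⟨hac, b, hb, hadj⟩)

end Elimination

/-- Ranking vertices by the depth of their top node, and then by a linear extension of `r`. -/
theorem exists_injective_rank {V : Type} [Finite V] (r : V → V → Prop) (hr : IsPartialOrder V r)
    (d : V → ℕ) : ∃ f : V → ℕ, f.Injective ∧ (∀ u v, f u ≤ f v → d u ≤ d v) ∧
      ∀ u v, u ≠ v → d u = d v → r u v → f u < f v := by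
  let q : V → V → Prop := fun u v => d u < d v ∨ d u = d v ∧ r u v
  have hq : IsPartialOrder V q :=
    { refl := fun u => Or.inr ⟨rfl, hr.refl u⟩
      trans := by
        rintro u v w (h | ⟨h, huv⟩) (h' | ⟨h', hvw⟩)
        · exact Or.inl (h.trans h')
        · exact Or.inl (h' ▸ h)
        · exact Or.inl (h ▸ h')
        · exact Or.inr ⟨h.trans h', hr.trans u v w huv hvw⟩
      antisymm := by
        rintro u v (h | ⟨h, huv⟩) (h' | ⟨h', hvu⟩)
        · omega
        · omega
        · omega
        · exact hr.antisymm u v huv hvu }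
  obtain ⟨s, hs, hqs⟩ := extend_partialOrder q
  have hlt : ∀ u v, s u v → u ≠ v → {x | s x u}.ncard < {x | s x v}.ncard := by
    intro u v huv hne
    refine Set.ncard_lt_ncard ⟨fun x hx => hs.trans x u v hx huv, fun h => ?_⟩ (Set.toFinite _)
    exact hne (hs.antisymm u v huv (h (hs.refl v)))
  refine ⟨fun v => {x | s x v}.ncard, fun u v huv => ?_, fun u v huv => ?_, fun u v hne hd huv =>
    hlt u v (hqs u v (Or.inr ⟨hd, huv⟩)) hne⟩
  · by_contra hne
    rcases hs.total u v with h | h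
    · exact (hlt u v h hne).ne huv
    · exact (hlt v u h (Ne.symm hne)).ne huv.symm
  · by_contra! hd
    have hne : v ≠ u := by
      rintro rfl
      exact lt_irrefl _ hd
    exact absurd (hlt v u (hqs v u (Or.inl hd)) hne) (not_lt.mpr huv)

namespace TreeDecomp

variable {V : Type} {G : SimpleGraph V} {ι : Type} [Fintype ι] {D : TreeDecomp G ι}
  {top : V → ι} {f : V → ℕ}

/-- If ranks respect the depth of top nodes, then the top node of `v` lies above the top nodes
of all vertices in the component of `v`. -/
theorem ancIn_top_of_mem_elimComp (htop : ∀ v, D.IsTop v (top v))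
    (hf : ∀ u v, f u ≤ f v → D.T.dist D.root (top u) ≤ D.T.dist D.root (top v)) {u v : V}
    (h : u ∈ elimComp G f v) : ancIn D.T D.root (top v) (top u) := by
  refine ReachAvoid.mem_of_closed (C := {u | ancIn D.T D.root (top v) (top u)}) h ancIn_refl ?_
  intro a b hb hadj ha
  obtain ⟨s, has, hbs⟩ := D.coverEdge a b hadj
  rcases (hb.trans ((htop b).2 s hbs)).total D.isTree.connected ((htop a).2 s has) with h' | h'
  · exact h'
  · have := h'.eq_of_dist_le D.isTree.connected (hf v a (not_lt.mp ha))
    change ancIn D.T D.root (top v) (top a)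
    rw [this]
    exact ancIn_refl

theorem elimNbrs_subset_bag (htop : ∀ v, D.IsTop v (top v))
    (hf : ∀ u v, f u ≤ f v → D.T.dist D.root (top u) ≤ D.T.dist D.root (top v)) {u v : V}
    (h : u ∈ elimNbrs G f v) : u ∈ D.bag (top v) := by
  obtain ⟨-, x, hx, hadj⟩ := id h
  obtain ⟨s, hus, hxs⟩ := D.coverEdge u x hadj
  exact (htop u).mem_bag_of_ancIn hus
    (ancIn_top_of_mem_elimComp htop hf (mem_elimComp_of_mem_elimNbrs h))
    ((ancIn_top_of_mem_elimComp htop hf hx).trans ((htop x).2 s hxs))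

end TreeDecomp

/-- Every dependency tree decomposition of width `ω` can be
transformed into one of width at most `ω` whose root bag is empty and in which, for
every node `t` with child `c`, the set `χ(T_c) ∖ χ(t)` is a connected component of
`G ∖ χ(t)`. -/
theorem depTreeDecomp_normalize {V : Type} [Fintype V] [DecidableEq V]
    (G : SimpleGraph V) (r : V → V → Prop) (hr : IsPartialOrder V r)
    (n : ℕ) (D : TreeDecomp G (Fin n)) (hD : D.Dep r) :
    ∃ (m : ℕ) (D' : TreeDecomp G (Fin m)), D'.Dep r ∧ D'.width ≤ D.width ∧
      D'.bag D'.root = ∅ ∧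
      ∀ t c : Fin m, childIn D'.T D'.root t c →
        IsCompAvoid G (↑(D'.bag t) : Set V) (D'.subtreeBags c \ ↑(D'.bag t)) := by
  choose top htop using D.exists_isTop
  obtain ⟨f, hinj, hd, hlt⟩ := exists_injective_rank r hr fun v => D.T.dist D.root (top v)
  obtain ⟨m, D', node, hroot, hnode, hbag, htop', hanc, hchild⟩ :=
    exists_treeDecomp_of_injective G hinj
  refine ⟨m, D', ?_, ?_, hroot, hchild⟩
  · intro u v tu tv hu hv hancuv hne hvu
    obtain rfl := hu.unique (htop' u)
    obtain rfl := hv.unique (htop' v)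
    have hmem := hanc u v hancuv
    have huv := TreeDecomp.ancIn_top_of_mem_elimComp htop hd hmem
    by_cases htuv : top u = top v
    · have hvu_ne : v ≠ u := fun h => hne (by rw [h])
      exact absurd (hlt v u hvu_ne (by rw [htuv]) hvu) (not_lt.mpr (le_of_mem_elimComp hmem))
    · exact hD u v _ _ (htop u) (htop v) huv htuv hvu
  · refine Nat.sub_le_sub_right (Finset.sup_le fun t _ => ?_) 1
    by_cases ht : t = D'.root
    · simp [ht, hroot]
    · obtain ⟨v, rfl⟩ := hnode t ht
      refine le_trans (Finset.card_le_card fun u hu => ?_)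
        (Finset.le_sup (f := fun t => (D.bag t).card) (Finset.mem_univ (top v)))
      rw [← Finset.mem_coe, hbag] at hu
      rcases hu with rfl | hu
      · exact (htop u).1
      · exact TreeDecomp.elimNbrs_subset_bag htop hd hu
end
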